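/- Let g ~ CN(0, ρ²) and w ~ CN(0, 1) be independent circularly symmetric complex Gaussian random variables. Then E[|w|²/(1 + |g+w|²)] ≤ (ρ²·e^{−1/ρ²}·ln(1+ρ²))/(ρ²+1)² + 1/(1+ρ²) − (ρ²·E₁(1))/(ρ²+1)² + (−e^{−1/ρ²}ρ⁴ + ρ⁴ − 3ρ²/e + 2ρ² − 2/e + 1)/(ρ²+1)². -/

import Mathlib

open MeasureTheory Real Set ProbabilityTheory

/-- The exponential integral E₁(x) = ∫ₓ^∞ e^{−t}/t dt. -/
noncomputable def expIntegralE1 (x : ℝ) : ℝ := ∫ t in Set.Ioi x, Real.exp (-t) / t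

/-- The circularly symmetric complex Gaussian distribution CN(0, v): real and imaginary
parts are independent real Gaussians of mean 0 and variance v/2. -/
noncomputable def complexGaussian (v : ℝ) : Measure ℂ :=
  Measure.map (fun p : ℝ × ℝ => (p.1 : ℂ) + (p.2 : ℂ) * Complex.I)
    ((gaussianReal 0 (Real.toNNReal (v / 2))).prod (gaussianReal 0 (Real.toNNReal (v / 2))))


lemma aux_Gderiv (s : ℝ) (hs : 0 < s) (x : ℝ) :
    HasDerivAt (fun x : ℝ => Real.exp (-x^2) * (Real.log (1 + s * x^2) - Real.log (1 + s)
      - s * x^2 / (1 + s)) / s)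
      (2 * x * Real.exp (-x^2) / (1 + s * x^2)
        + 2 * x * Real.exp (-x^2) * ((s * x^2 - s) / (1 + s)
          - (Real.log (1 + s * x^2) - Real.log (1 + s))) / s) x := by
  have h1 : HasDerivAt (fun x : ℝ => x^2) (2 * x) x := by simpa using hasDerivAt_pow 2 x
  have h2 : (1 + s * x^2) ≠ 0 := by positivity
  have h3 := (((h1.const_mul s).const_add 1).log h2)
  have h4 := (h1.neg.exp).mul (((h3.sub_const (Real.log (1 + s))).sub
    ((h1.const_mul s).div_const (1 + s))))
  refine (h4.div_const s).congr_deriv ?_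
  have h5 : 1 + s ≠ 0 := by positivity
  simp only [Pi.neg_apply, Pi.sub_apply]
  field_simp
  ring

lemma aux_log (s t : ℝ) (hs : 0 < s) (ht : 0 ≤ t) :
    0 ≤ (t - s) / (1 + s) - (Real.log (1 + t) - Real.log (1 + s)) := by
  rw [← Real.log_div (by positivity) (by positivity)]
  have := Real.log_le_sub_one_of_pos (x := (1 + t) / (1 + s)) (by positivity)
  have e : (1 + t) / (1 + s) - 1 = (t - s) / (1 + s) := by field_simp; ring
  linarith

lemma aux_tendsto (s : ℝ) (hs : 0 < s) :
    Filter.Tendsto (fun x : ℝ => Real.exp (-x^2) * (Real.log (1 + s * x^2) - Real.log (1 + s)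
      - s * x^2 / (1 + s)) / s) Filter.atTop (nhds 0) := by
  have key : Filter.Tendsto (fun t : ℝ => Real.exp (-t) * (Real.log (1 + s * t) - Real.log (1 + s)
      - s * t / (1 + s)) / s) Filter.atTop (nhds 0) := by
    have a0 : Filter.Tendsto (fun t : ℝ => Real.exp (-t)) Filter.atTop (nhds 0) :=
      Real.tendsto_exp_neg_atTop_nhds_zero
    have a1 : Filter.Tendsto (fun t : ℝ => t * Real.exp (-t)) Filter.atTop (nhds 0) := by
      simpa using Real.tendsto_pow_mul_exp_neg_atTop_nhds_zero 1
    have a2 : Filter.Tendsto (fun t : ℝ => Real.exp (-t) * Real.log (1 + s * t))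
        Filter.atTop (nhds 0) := by
      refine squeeze_zero' (g := fun t => s * (t * Real.exp (-t))) ?_ ?_ (by simpa using a1.const_mul s)
      · filter_upwards [Filter.eventually_ge_atTop 0] with t ht
        have : 0 ≤ Real.log (1 + s * t) := Real.log_nonneg (by nlinarith [mul_nonneg hs.le ht])
        positivity
      · filter_upwards [Filter.eventually_ge_atTop 0] with t ht
        have h := Real.log_le_sub_one_of_pos (x := 1 + s * t) (by positivity)
        nlinarith [Real.exp_pos (-t)]
    have a3 := ((a2.sub (a0.mul_const (Real.log (1 + s)))).sub (a1.mul_const (s / (1 + s)))).div_const s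
    simp only [zero_mul, sub_zero, zero_div] at a3
    refine a3.congr (fun t => ?_)
    ring
  exact key.comp (Filter.tendsto_pow_atTop (by norm_num))

lemma aux_radial (s : ℝ) (hs : 0 < s) :
    ∫ x in Set.Ioi (0:ℝ), 2 * x * Real.exp (-x^2) / (1 + s * x^2) ≤ Real.log (1 + s) / s := by
  have hpos : ∀ x ∈ Set.Ioi (0:ℝ), 0 ≤ 2 * x * Real.exp (-x^2) / (1 + s * x^2) := by
    intro x hx
    have : 0 < x := hx
    positivity
  have hle : ∀ x ∈ Set.Ioi (0:ℝ), 2 * x * Real.exp (-x^2) / (1 + s * x^2) ≤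
      2 * x * Real.exp (-x^2) / (1 + s * x^2)
        + 2 * x * Real.exp (-x^2) * ((s * x^2 - s) / (1 + s)
          - (Real.log (1 + s * x^2) - Real.log (1 + s))) / s := by
    intro x hx
    have : 0 < x := hx
    have := aux_log s (s * x^2) hs (by positivity)
    have : 0 ≤ 2 * x * Real.exp (-x^2) * ((s * x^2 - s) / (1 + s)
          - (Real.log (1 + s * x^2) - Real.log (1 + s))) / s := by positivity
    linarith
  have hint := integrableOn_Ioi_deriv_of_nonneg' (a := 0) (fun x _ => aux_Gderiv s hs x)
    (fun x hx => (hpos x hx).trans (hle x hx)) (aux_tendsto s hs)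
  have hval := integral_Ioi_of_hasDerivAt_of_nonneg' (a := 0) (fun x _ => aux_Gderiv s hs x)
    (fun x hx => (hpos x hx).trans (hle x hx)) (aux_tendsto s hs)
  have : Real.log (1 + s) / s = 0 - Real.exp (-0^2) * (Real.log (1 + s * 0^2) - Real.log (1 + s)
      - s * 0^2 / (1 + s)) / s := by simp; ring
  rw [this, ← hval]
  refine integral_mono_of_nonneg ?_ hint ?_
  · exact (ae_restrict_iff' measurableSet_Ioi).2 (Filter.Eventually.of_forall hpos)
  · exact (ae_restrict_iff' measurableSet_Ioi).2 (Filter.Eventually.of_forall hle)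

lemma aux_J (s : ℝ) (hs : 0 < s) :
    ∫ p : ℝ × ℝ, 1 / (1 + s * (p.1^2 + p.2^2))
      ∂((gaussianReal 0 (Real.toNNReal (1 / 2))).prod (gaussianReal 0 (Real.toNNReal (1 / 2))))
      ≤ Real.log (1 + s) / s := by
  have hv : Real.toNNReal (1/2) ≠ 0 := by simp
  rw [gaussianReal_of_var_ne_zero _ hv,
    prod_withDensity (measurable_gaussianPDF _ _) (measurable_gaussianPDF _ _),
    integral_withDensity_eq_integral_toReal_smul (by fun_prop) 
      (Filter.Eventually.of_forall fun p => ENNReal.mul_lt_top gaussianPDF_lt_top gaussianPDF_lt_top)]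
  have h1 : ∀ p : ℝ × ℝ, (gaussianPDF 0 (Real.toNNReal (1/2)) p.1 *
      gaussianPDF 0 (Real.toNNReal (1/2)) p.2).toReal • (1 / (1 + s * (p.1^2 + p.2^2)))
      = π⁻¹ * (Real.exp (-(p.1^2+p.2^2)) / (1 + s * (p.1^2 + p.2^2))) := by
    intro p
    rw [ENNReal.toReal_mul, toReal_gaussianPDF, toReal_gaussianPDF]
    have e1 : (2 * π * ((Real.toNNReal (1/2) : NNReal) : ℝ)) = π := by
      rw [Real.coe_toNNReal _ (by norm_num)]; ring
    have e2 : (2 * ((Real.toNNReal (1/2) : NNReal) : ℝ)) = 1 := by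
      rw [Real.coe_toNNReal _ (by norm_num)]; ring
    simp only [gaussianPDFReal, e1, e2, sub_zero, div_one, smul_eq_mul]
    have e3 : (√π)⁻¹ * (√π)⁻¹ = π⁻¹ := by
      rw [← mul_inv, Real.mul_self_sqrt Real.pi_pos.le]
    rw [neg_add, Real.exp_add, ← e3]
    ring
  simp_rw [h1]
  rw [← Measure.volume_eq_prod, ← integral_comp_polarCoord_symm]
  have h2 : ∀ p : ℝ × ℝ, p.1 • (π⁻¹ * (Real.exp (-((polarCoord.symm p).1^2+(polarCoord.symm p).2^2)) /
      (1 + s * ((polarCoord.symm p).1^2 + (polarCoord.symm p).2^2))))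
      = (2 * p.1 * Real.exp (-p.1^2) / (1 + s * p.1^2)) * (2 * π)⁻¹ := by
    intro p
    have : (polarCoord.symm p).1^2 + (polarCoord.symm p).2^2 = p.1^2 := by
      simp only [polarCoord_symm_apply]
      linear_combination p.1^2 * Real.cos_sq_add_sin_sq p.2
    rw [this, smul_eq_mul, mul_inv]
    ring
  simp_rw [h2]
  rw [polarCoord_target, Measure.volume_eq_prod, setIntegral_prod_mul (fun x : ℝ => 2 * x * Real.exp (-x^2) / (1 + s * x^2)) 
    (fun _ : ℝ => (2 * π)⁻¹)]
  have h3 : ∫ _ in Set.Ioo (-π) π, (2 * π)⁻¹ = 1 := by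
    have := Real.pi_pos
    rw [setIntegral_const, smul_eq_mul, Measure.real, Real.volume_Ioo, ENNReal.toReal_ofReal (by linarith)]
    field_simp
    ring
  rw [h3, mul_one]
  exact aux_radial s hs

lemma aux_E1 : expIntegralE1 1 ≤ Real.exp (-1) := by
  unfold expIntegralE1
  rw [← integral_exp_neg_Ioi 1]
  refine integral_mono_of_nonneg ?_ (integrableOn_exp_neg_Ioi 1) ?_
  · refine (ae_restrict_iff' measurableSet_Ioi).2 (Filter.Eventually.of_forall fun x hx => ?_)
    have : (1:ℝ) < x := hx
    positivity
  · refine (ae_restrict_iff' measurableSet_Ioi).2 (Filter.Eventually.of_forall fun x hx => ?_)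
    have : (1:ℝ) < x := hx
    exact div_le_self (Real.exp_pos _).le this.le

lemma aux_final (r J : ℝ) (hr : 0 < r) (hJ0 : 0 ≤ J) (hJ : J ≤ Real.log (1 + (1 + r)) / (1 + r)) :
    1 / (1 + r)^2 + (r / (1 + r) - 1 / (1 + r)^2) * J ≤
      r * Real.exp (-1 / r) * Real.log (1 + r) / (r + 1) ^ 2
        + 1 / (1 + r)
        - r * expIntegralE1 1 / (r + 1) ^ 2
        + (-Real.exp (-1 / r) * r ^ 2 + r ^ 2 - 3 * r / Real.exp 1
            + 2 * r - 2 / Real.exp 1 + 1) / (r + 1) ^ 2 := by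
  have hE := aux_E1
  have he : Real.exp (-1) < 0.368 := by
    rw [Real.exp_neg, inv_lt_comm₀ (Real.exp_pos _) (by norm_num)]
    have := Real.exp_one_gt_d9
    norm_num at this ⊢
    linarith
  set q := Real.exp (-1) with hq
  have hq1 : ∀ x : ℝ, x / Real.exp 1 = x * q := by
    intro x; rw [hq, Real.exp_neg]; rfl
  rw [hq1, hq1]
  set ε := Real.exp (-1 / r) with hε
  set L := Real.log (1 + r) with hL
  set M := Real.log (1 + (1 + r)) with hM
  have hL0 : 0 ≤ L := Real.log_nonneg (by linarith)
  have hLr : L ≤ r := by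
    have := Real.log_le_sub_one_of_pos (x := 1 + r) (by linarith)
    linarith
  have hM1 : (M - L) * (1 + r) ≤ 1 := by
    rw [← le_div_iff₀ (by positivity), hM, hL, ← Real.log_div (by positivity) (by positivity)]
    have := Real.log_le_sub_one_of_pos (x := (1 + (1 + r)) / (1 + r)) (by positivity)
    have e : (1 + (1 + r)) / (1 + r) - 1 = 1 / (1 + r) := by field_simp; ring
    linarith
  have hε1 : ε * (1 + r) ≤ r := by
    have h1 := Real.add_one_le_exp (1 / r)
    have h2 : ε = (Real.exp (1 / r))⁻¹ := by rw [hε, ← Real.exp_neg]; congr 1; ring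
    rw [h2, inv_mul_le_iff₀ (Real.exp_pos _)]
    have h3 : (1 / r + 1) * r = 1 + r := by field_simp
    nlinarith
  have hε2 : (1 - ε) * r ≤ 1 := by
    have h1 := Real.add_one_le_exp (-1 / r)
    have h3 : (-1 / r + 1) * r = -1 + r := by field_simp
    nlinarith
  have hε0 : 0 < ε := Real.exp_pos _
  have hJ' : J * (1 + r) ≤ M := by rwa [le_div_iff₀ (by positivity)] at hJ
  -- main
  have hεL : (1 - ε) * L * (1 + r) ≤ 2 * r := by
    have hε3 : ε ≤ 1 := by nlinarith
    rcases le_total r 1 with h | h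
    · have : (1 - ε) * L ≤ r := by nlinarith
      nlinarith
    · have : (1 - ε) * L ≤ 1 := by nlinarith
      nlinarith
  have hmain : M * r ≤ r * ε * L + (1 + r) - r * q + (-ε * r^2 + r^2 - 3 * r * q + 2 * r - 2 * q + 1) - 1 := by
    have h5 : M ≤ ε * L + 1 + (1 - ε) * r + 2 - 4 * q := by
      have : M * (1 + r) ≤ (ε * L + 1 + (1 - ε) * r + 2 - 4 * q) * (1 + r) := by nlinarith
      exact le_of_mul_le_mul_right this (by positivity)
    nlinarith
  have hrE : r * expIntegralE1 1 ≤ r * q := by gcongr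
  have hJr : J * (1 + r) * r ≤ M * r := by gcongr
  have : 1 + (r * (1 + r) - 1) * J ≤ r * ε * L + (1 + r) - r * expIntegralE1 1 +
    (-ε * r^2 + r^2 - 3 * r * q + 2 * r - 2 * q + 1) := by nlinarith
  have h6 : 1 / (1 + r)^2 + (r / (1 + r) - 1 / (1 + r)^2) * J
      = (1 + (r * (1 + r) - 1) * J) / (r + 1)^2 := by
    field_simp; ring
  have h7 : r * ε * L / (r + 1) ^ 2
        + 1 / (1 + r)
        - r * expIntegralE1 1 / (r + 1) ^ 2
        + (-ε * r ^ 2 + r ^ 2 - 3 * r * q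
            + 2 * r - 2 * q + 1) / (r + 1) ^ 2 = (r * ε * L + (1 + r) - r * expIntegralE1 1 +
    (-ε * r^2 + r^2 - 3 * r * q + 2 * r - 2 * q + 1)) / (r + 1)^2 := by
    field_simp; ring
  rw [h6, h7]
  gcongr

noncomputable def auxL : ℝ × ℝ →L[ℝ] ℂ := Complex.equivRealProdCLM.symm.toContinuousLinearMap

lemma auxL_apply (p : ℝ × ℝ) : auxL p = (p.1 : ℂ) + (p.2 : ℂ) * Complex.I := by
  simp [auxL, Complex.equivRealProdCLM_symm_apply]

lemma auxL_norm (p : ℝ × ℝ) : ‖auxL p‖^2 = p.1^2 + p.2^2 := by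
  rw [auxL_apply, ← Complex.normSq_eq_norm_sq, Complex.normSq_add_mul_I]

lemma aux_cg (v : ℝ) : complexGaussian v = Measure.map auxL
    ((gaussianReal 0 (Real.toNNReal (v / 2))).prod (gaussianReal 0 (Real.toNNReal (v / 2)))) := by
  unfold complexGaussian
  congr 1
  ext p
  rw [auxL_apply]

instance aux_isGaussian (v : ℝ) : IsGaussian (complexGaussian v) := by
  rw [aux_cg]; infer_instance

lemma aux_scale (ρ : ℝ) : complexGaussian (ρ^2) =
    Measure.map (fun z : ℂ => ρ • z) (complexGaussian 1) := by
  rw [aux_cg, aux_cg, Measure.map_map (by fun_prop) (by fun_prop)]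
  have h : gaussianReal 0 (Real.toNNReal (ρ^2/2)) =
      (gaussianReal 0 (Real.toNNReal (1/2))).map (ρ * ·) := by
    rw [gaussianReal_map_const_mul, mul_zero]
    congr 1
    ext
    rw [NNReal.coe_mul, Real.coe_toNNReal _ (by positivity), Real.coe_toNNReal _ (by positivity)]
    simp only [NNReal.coe_mk]
    ring
  rw [h, Measure.map_prod_map _ _ (by fun_prop) (by fun_prop),
    Measure.map_map (by fun_prop) (by fun_prop)]
  congr 1
  ext p
  simp [auxL_apply]
  ring

lemma aux_mean : ∫ z, z ∂(complexGaussian 1) = 0 := by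
  rw [aux_cg, integral_map (by fun_prop) (by fun_prop), ContinuousLinearMap.integral_comp_id_comm]
  · have : ∫ x, x ∂((gaussianReal 0 (Real.toNNReal (1 / 2))).prod
        (gaussianReal 0 (Real.toNNReal (1 / 2)))) = 0 := by
      have hi : Integrable (fun x : ℝ × ℝ => x) ((gaussianReal 0 (Real.toNNReal (1 / 2))).prod
        (gaussianReal 0 (Real.toNNReal (1 / 2)))) := IsGaussian.integrable_id
      ext
      · rw [fst_integral hi, integral_fun_fst (f := fun x : ℝ => x)]
        simp
      · rw [snd_integral hi, integral_fun_snd (f := fun x : ℝ => x)]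
        simp
    rw [this, map_zero]
  · exact IsGaussian.integrable_id

lemma aux_sq_int (v : ℝ) : Integrable (fun z : ℂ => ‖z‖^2) (complexGaussian v) :=
  (IsGaussian.memLp_two_id (μ := complexGaussian v)).integrable_norm_pow (by norm_num)

lemma aux_sq : ∫ z, ‖z‖^2 ∂(complexGaussian 1) = 1 := by
  rw [aux_cg, integral_map (by fun_prop) (by fun_prop)]
  simp_rw [auxL_norm]
  have h2 : Integrable (fun x : ℝ => x^2) (gaussianReal 0 (Real.toNNReal (1 / 2))) :=
    (IsGaussian.memLp_two_id (μ := gaussianReal 0 (Real.toNNReal (1 / 2)))).integrable_sq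
  have h3 : ∫ x, x^2 ∂(gaussianReal 0 (Real.toNNReal (1 / 2))) = 1/2 := by
    have h := variance_id_gaussianReal (μ := 0) (v := Real.toNNReal (1 / 2))
    rw [variance_of_integral_eq_zero (by fun_prop) (by simp)] at h
    simpa using h
  rw [integral_add (h2.comp_fst _) (h2.comp_snd _), integral_fun_fst (f := fun x : ℝ => x^2),
    integral_fun_snd (f := fun x : ℝ => x^2), h3]
  simp
  norm_num

lemma aux_inner (a : ℂ) (c d : ℝ) :
    ∫ b, ‖c • a + d • b‖^2 ∂(complexGaussian 1) = c^2 * ‖a‖^2 + d^2 := by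
  have h : ∀ b : ℂ, ‖c • a + d • b‖^2 = (c^2 * ‖a‖^2 + 2 * c * d * inner ℝ a b) + d^2 * ‖b‖^2 := by
    intro b
    rw [norm_add_sq_real, norm_smul, norm_smul, real_inner_smul_left, real_inner_smul_right,
      mul_pow, mul_pow, Real.norm_eq_abs, Real.norm_eq_abs, sq_abs, sq_abs]
    ring
  simp_rw [h]
  have hid : Integrable (fun z : ℂ => z) (complexGaussian 1) := IsGaussian.integrable_id
  have hi : Integrable (fun b : ℂ => 2 * c * d * inner ℝ a b) (complexGaussian 1) :=
    (hid.const_inner a).const_mul _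
  have hi2 : Integrable (fun b : ℂ => c^2 * ‖a‖^2 + 2 * c * d * inner ℝ a b) (complexGaussian 1) :=
    (integrable_const _).add hi
  rw [integral_add hi2 ((aux_sq_int 1).const_mul _),
    integral_add (integrable_const _) hi, integral_const_mul, integral_const_mul, integral_const_mul, aux_sq,
    integral_inner hid, aux_mean]
  simp

/-- For independent g ~ CN(0, ρ²) and w ~ CN(0, 1),
E[|w|²/(1+|g+w|²)] ≤ ρ²e^{−1/ρ²}ln(1+ρ²)/(ρ²+1)² + 1/(1+ρ²) − ρ²E₁(1)/(ρ²+1)²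
  + (−e^{−1/ρ²}ρ⁴ + ρ⁴ − 3ρ²/e + 2ρ² − 2/e + 1)/(ρ²+1)². -/
theorem expectation_noise_over_one_add_sq_bound
    {Ω : Type*} [MeasurableSpace Ω] (P : Measure Ω) [IsProbabilityMeasure P]
    (ρ : ℝ) (hρ : 0 < ρ) (g w : Ω → ℂ)
    (hg : Measure.map g P = complexGaussian (ρ ^ 2))
    (hw : Measure.map w P = complexGaussian 1)
    (hindep : IndepFun g w P) :
    ∫ ω, ‖w ω‖ ^ 2 / (1 + ‖g ω + w ω‖ ^ 2) ∂P
      ≤ ρ ^ 2 * Real.exp (-1 / ρ ^ 2) * Real.log (1 + ρ ^ 2) / (ρ ^ 2 + 1) ^ 2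
        + 1 / (1 + ρ ^ 2)
        - ρ ^ 2 * expIntegralE1 1 / (ρ ^ 2 + 1) ^ 2
        + (-Real.exp (-1 / ρ ^ 2) * ρ ^ 4 + ρ ^ 4 - 3 * ρ ^ 2 / Real.exp 1
            + 2 * ρ ^ 2 - 2 / Real.exp 1 + 1) / (ρ ^ 2 + 1) ^ 2 := by
  have hgm : AEMeasurable g P := by
    apply AEMeasurable.of_map_ne_zero
    rw [hg]; exact IsProbabilityMeasure.ne_zero _
  have hwm : AEMeasurable w P := by
    apply AEMeasurable.of_map_ne_zero
    rw [hw]; exact IsProbabilityMeasure.ne_zero _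
  have hjoint := (indepFun_iff_map_prod_eq_prod_map_map hgm hwm).1 hindep
  rw [hg, hw, aux_scale] at hjoint
  set μ := complexGaussian 1 with hμ
  set s : ℝ := 1 + ρ^2 with hs
  have hs0 : 0 < s := by positivity
  have hsq : √s ^ 2 = s := Real.sq_sqrt hs0.le
  have hsp : 0 < √s := Real.sqrt_pos.2 hs0
  -- the angle
  obtain ⟨θ, hc, hsn⟩ : ∃ θ : ℝ, Real.cos θ = ρ / √s ∧ Real.sin θ = 1 / √s := by
    refine ⟨Complex.arg ⟨ρ / √s, 1 / √s⟩, ?_⟩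
    have hn : ‖(⟨ρ / √s, 1 / √s⟩ : ℂ)‖ = 1 := by
      have : ‖(⟨ρ / √s, 1 / √s⟩ : ℂ)‖^2 = 1 := by
        rw [← Complex.normSq_eq_norm_sq, Complex.normSq_mk]
        field_simp
        rw [hsq, hs]; ring
      exact (pow_eq_one_iff_of_nonneg (norm_nonneg _) two_ne_zero).1 this
    constructor
    · rw [Complex.cos_arg (by rw [← norm_ne_zero_iff, hn]; norm_num), hn]; simp
    · rw [Complex.sin_arg, hn]; simp
  have hrot := IsGaussian.map_rotation_eq_self (μ := μ) aux_mean θ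
  set c := Real.cos θ with hcd
  set d := Real.sin θ with hdd
  have hc2 : c^2 = ρ^2 / s := by rw [hc, div_pow, hsq]
  have hd2 : d^2 = 1 / s := by rw [hsn, div_pow, hsq, one_pow]
  have hcd1 : c^2 + d^2 = 1 := Real.cos_sq_add_sin_sq θ
  have hsc : √s * c = ρ := by rw [hc]; field_simp
  have hsd : √s * d = 1 := by rw [hsn]; field_simp
  -- rewrite the expectation
  let F : ℂ × ℂ → ℝ := fun q => ‖d • q.1 + c • q.2‖^2 / (1 + s * ‖q.1‖^2)
  have hpos : ∀ a : ℂ, 0 < 1 + s * ‖a‖^2 := fun a => by positivity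
  have hFc : Continuous F := by
    refine Continuous.div (by fun_prop) (by fun_prop) (fun q => (hpos q.1).ne')
  have hE : ∫ ω, ‖w ω‖ ^ 2 / (1 + ‖g ω + w ω‖ ^ 2) ∂P = ∫ q, F q ∂(μ.prod μ) := by
    have hmeas : Measurable (fun q : ℂ × ℂ => ‖q.2‖ ^ 2 / (1 + ‖q.1 + q.2‖ ^ 2)) := by fun_prop
    have e1 : ∫ ω, ‖w ω‖ ^ 2 / (1 + ‖g ω + w ω‖ ^ 2) ∂P
        = ∫ q : ℂ × ℂ, ‖q.2‖ ^ 2 / (1 + ‖q.1 + q.2‖ ^ 2) ∂(P.map (fun ω => (g ω, w ω))) := by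
      rw [integral_map (hgm.prodMk hwm) hmeas.aestronglyMeasurable]
    have e2 : (Measure.map (fun z : ℂ => ρ • z) μ).prod μ
        = Measure.map (Prod.map (fun z : ℂ => ρ • z) id) (μ.prod μ) := by
      rw [← Measure.map_prod_map _ _ (by fun_prop) (by fun_prop), Measure.map_id]
    rw [e1, hjoint, e2, integral_map (by fun_prop) hmeas.aestronglyMeasurable]
    conv_rhs => rw [← hrot]
    rw [integral_map (by fun_prop) hFc.aestronglyMeasurable]
    congr 1
    ext q
    simp only [F, ContinuousLinearMap.rotation_apply, Prod.map_fst, Prod.map_snd, id]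
    rw [← hcd, ← hdd]
    have f1 : d • (c • q.1 + d • q.2) + c • (-d • q.1 + c • q.2) = q.2 := by
      have : d • (c • q.1 + d • q.2) + c • (-d • q.1 + c • q.2) = (c^2 + d^2) • q.2 := by module
      rw [this, hcd1, one_smul]
    have f2 : s * ‖c • q.1 + d • q.2‖^2 = ‖ρ • q.1 + q.2‖^2 := by
      have : ρ • q.1 + q.2 = √s • (c • q.1 + d • q.2) := by
        rw [smul_add, smul_smul, smul_smul, hsc, hsd, one_smul]
      rw [this, norm_smul, mul_pow, Real.norm_eq_abs, sq_abs, hsq]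
    rw [f1, f2]
  have hFint : Integrable F (μ.prod μ) := by
    have hb : Integrable (fun q : ℂ × ℂ => 2 * (d^2 * ‖q.1‖^2) + 2 * (c^2 * ‖q.2‖^2)) (μ.prod μ) :=
      ((((aux_sq_int 1).comp_fst μ).const_mul _).const_mul _).add
        ((((aux_sq_int 1).comp_snd μ).const_mul _).const_mul _)
    refine hb.mono' hFc.aestronglyMeasurable (Filter.Eventually.of_forall fun q => ?_)
    have h0 : 0 ≤ F q := by have := hpos q.1; positivity
    rw [Real.norm_eq_abs, abs_of_nonneg h0]
    have h1 : F q ≤ ‖d • q.1 + c • q.2‖^2 := 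
      div_le_self (by positivity) (by have : 0 ≤ s * ‖q.1‖^2 := by positivity
                                      linarith)
    have h2 := parallelogram_law_with_norm ℝ (d • q.1) (c • q.2)
    have h3 : ‖d • q.1‖^2 = d^2 * ‖q.1‖^2 := by rw [norm_smul, mul_pow, Real.norm_eq_abs, sq_abs]
    have h4 : ‖c • q.2‖^2 = c^2 * ‖q.2‖^2 := by rw [norm_smul, mul_pow, Real.norm_eq_abs, sq_abs]
    nlinarith [sq_nonneg ‖d • q.1 - c • q.2‖]
  have hinner : ∀ a : ℂ, ∫ b, F (a, b) ∂μ = 1 / s^2 + (ρ^2 / s - 1 / s^2) * (1 / (1 + s * ‖a‖^2)) := by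
    intro a
    simp only [F]
    rw [integral_div, aux_inner, hc2, hd2]
    have := hpos a
    field_simp
    ring
  have hJi : Integrable (fun a : ℂ => 1 / (1 + s * ‖a‖^2)) μ := by
    refine (integrable_const (1:ℝ)).mono' (Measurable.aestronglyMeasurable (by fun_prop)) (Filter.Eventually.of_forall fun a => ?_)
    have := hpos a
    rw [Real.norm_eq_abs, abs_of_nonneg (by positivity), div_le_one this]
    have : 0 ≤ s * ‖a‖^2 := by positivity
    linarith
  have hval : ∫ q, F q ∂(μ.prod μ) = 1 / s^2 + (ρ^2 / s - 1 / s^2) * ∫ a, 1 / (1 + s * ‖a‖^2) ∂μ := by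
    rw [integral_prod _ hFint]
    simp_rw [hinner]
    rw [integral_add (integrable_const _) (hJi.const_mul _), integral_const_mul]
    simp
  have hJ0 : 0 ≤ ∫ a, 1 / (1 + s * ‖a‖^2) ∂μ :=
    integral_nonneg fun a => by have := hpos a; positivity
  have hJ : ∫ a, 1 / (1 + s * ‖a‖^2) ∂μ ≤ Real.log (1 + s) / s := by
    rw [hμ, aux_cg, integral_map (by fun_prop) (Measurable.aestronglyMeasurable (by fun_prop))]
    simp_rw [auxL_norm]
    exact aux_J s hs0
  rw [hE, hval]
  have := aux_final (ρ^2) _ (by positivity) hJ0 hJ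
  rw [show ρ^4 = (ρ^2)^2 by ring]
  exact this
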